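/- For every positive integer c there exists N such that every metric on N ordered points which is monochromatic of colour 123 — i.e. every quadruple of indices a < b < c < d satisfies R₁ > R₂ > R₃, where R₁ = d(a,b) + d(c,d), R₂ = d(a,c) + d(b,d), R₃ = d(a,d) + d(b,c) — admits an isometric embedding into l_∞^{N−c}. -/

import Mathlib

/-- `l_∞^k`: `ℝ^k` with the supremum distance. -/
abbrev LinfSpace (k : ℕ) := PiLp ⊤ (fun _ : Fin k => ℝ)

/-- A metric on `Fin n`, given as an explicit distance function. -/
def IsMetric {n : ℕ} (d : Fin n → Fin n → ℝ) : Prop :=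
  (∀ i, d i i = 0) ∧ (∀ i j, d i j = d j i) ∧ (∀ i j, i ≠ j → 0 < d i j) ∧
  (∀ i j k, d i k ≤ d i j + d j k)

/-- Weak Monge inequality coming from colour 123. -/
theorem monge_aux {N : ℕ} (d : Fin N → Fin N → ℝ) (hd : IsMetric d)
    (h : ∀ a b c' e : Fin N, a < b → b < c' → c' < e →
        d a b + d c' e > d a c' + d b e ∧ d a c' + d b e > d a e + d b c')
    (s s' t t' : Fin N) (hs : s ≤ s') (ht : t ≤ t')
    (h1 : s ≠ t) (h2 : s ≠ t') (h3 : s' ≠ t) (h4 : s' ≠ t') :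
    d s t' + d s' t ≤ d s t + d s' t' := by
  obtain ⟨_, hsym, _, _⟩ := hd
  rcases hs.eq_or_lt with rfl | hs
  · linarith
  rcases ht.eq_or_lt with rfl | ht
  · linarith
  rcases lt_or_gt_of_ne h1 with a1 | a1 <;> rcases lt_or_gt_of_ne h2 with a2 | a2 <;>
  rcases lt_or_gt_of_ne h3 with a3 | a3 <;> rcases lt_or_gt_of_ne h4 with a4 | a4 <;>
  first
  | (exfalso; omega)
  | skip
  · linarith [(h s s' t t' hs a3 ht).1, (h s s' t t' hs a3 ht).2, hsym s s', hsym s t, hsym s t',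
      hsym s' t, hsym s' t', hsym t t']
  · linarith [(h s t s' t' a1 a3 a4).1, (h s t s' t' a1 a3 a4).2, hsym s s', hsym s t, hsym s t',
      hsym s' t, hsym s' t', hsym t t']
  · linarith [(h s t t' s' a1 ht a4).1, (h s t t' s' a1 ht a4).2, hsym s s', hsym s t, hsym s t',
      hsym s' t, hsym s' t', hsym t t']
  · linarith [(h t s s' t' a1 hs a4).1, (h t s s' t' a1 hs a4).2, hsym s s', hsym s t, hsym s t',
      hsym s' t, hsym s' t', hsym t t']
  · linarith [(h t s t' s' a1 a2 a4).1, (h t s t' s' a1 a2 a4).2, hsym s s', hsym s t, hsym s t',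
      hsym s' t, hsym s' t', hsym t t']
  · linarith [(h t t' s s' ht a2 hs).1, (h t t' s s' ht a2 hs).2, hsym s s', hsym s t, hsym s t',
      hsym s' t, hsym s' t', hsym t t']

/-- The potentials along a staircase: `(u n, v n)`. -/
noncomputable def potAux {N : ℕ} (d : Fin N → Fin N → ℝ) (S T : ℕ → Fin N) : ℕ → ℝ × ℝ
  | 0 => (d (S 0) (T 0), 0)
  | n + 1 => ((potAux d S T n).2 + d (S (n+1)) (T n),
      (potAux d S T n).2 + d (S (n+1)) (T n) - d (S (n+1)) (T (n+1)))

/-- A staircase sequence is realised by a 1-Lipschitz function. -/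
theorem staircase_seq {N : ℕ} (d : Fin N → Fin N → ℝ) (hd : IsMetric d)
    (h : ∀ a b c' e : Fin N, a < b → b < c' → c' < e →
        d a b + d c' e > d a c' + d b e ∧ d a c' + d b e > d a e + d b c')
    (S T : ℕ → Fin N) (hS : Monotone S) (hT : Antitone T) (hST : ∀ m n, S m ≠ T n) (K : ℕ) :
    ∃ f : Fin N → ℝ, (∀ x y, f x - f y ≤ d x y) ∧ ∀ n ≤ K, f (S n) - f (T n) = d (S n) (T n) := by
  have hM := monge_aux d hd h
  obtain ⟨h0, hsym, _, htri⟩ := hd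
  set u : ℕ → ℝ := fun n => (potAux d S T n).1 with hu
  set v : ℕ → ℝ := fun n => (potAux d S T n).2 with hv
  have hu1 : ∀ n, u (n+1) = v n + d (S (n+1)) (T n) := fun n => rfl
  have hv1 : ∀ n, v (n+1) = v n + d (S (n+1)) (T n) - d (S (n+1)) (T (n+1)) := fun n => rfl
  have huv : ∀ n, u n - v n = d (S n) (T n) := by
    intro n
    cases n with
    | zero => simp [hu, hv, potAux]
    | succ n => rw [hu1, hv1]; ring
  have key1 : ∀ m k, u m - v (m + k) ≤ d (S m) (T (m + k)) := by
    intro m k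
    induction k with
    | zero => exact (huv m).le
    | succ k ih =>
      have e := hv1 (m + k)
      have := hM (S m) (S (m + k + 1)) (T (m + k + 1)) (T (m + k)) (hS (by omega)) (hT (by omega))
        (hST _ _) (hST _ _) (hST _ _) (hST _ _)
      rw [← add_assoc, e]
      linarith
  have key2 : ∀ n k, u (n + k) - v n ≤ d (S (n + k)) (T n) := by
    intro n k
    induction k with
    | zero => exact (huv n).le
    | succ k ih =>
      have e := hu1 (n + k)
      have e2 := huv (n + k)
      have := hM (S (n + k)) (S (n + k + 1)) (T (n + k)) (T n) (hS (by omega)) (hT (by omega))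
        (hST _ _) (hST _ _) (hST _ _) (hST _ _)
      rw [← add_assoc, e]
      linarith
  have key : ∀ m n, u m - v n ≤ d (S m) (T n) := by
    intro m n
    rcases le_total m n with hmn | hmn
    · obtain ⟨k, rfl⟩ := Nat.exists_eq_add_of_le hmn
      exact key1 m k
    · obtain ⟨k, rfl⟩ := Nat.exists_eq_add_of_le hmn
      exact key2 n k
  have hne : (Finset.range (K + 1)).Nonempty := ⟨0, by simp⟩
  refine ⟨fun x => (Finset.range (K + 1)).inf' hne (fun n => v n + d (T n) x), ?_, ?_⟩
  · intro x y
    obtain ⟨n, hn, e⟩ := Finset.exists_mem_eq_inf' hne (fun n => v n + d (T n) y)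
    have h1 : (Finset.range (K + 1)).inf' hne (fun n => v n + d (T n) x) ≤ v n + d (T n) x :=
      Finset.inf'_le _ hn
    have h2 := htri (T n) y x
    have h3 := hsym x y
    simp only [e]
    linarith
  · intro n hn
    have hmem : n ∈ Finset.range (K + 1) := by simp; omega
    have e1 : (Finset.range (K + 1)).inf' hne (fun m => v m + d (T m) (S n)) = u n := by
      apply le_antisymm
      · have h1 : (Finset.range (K + 1)).inf' hne (fun m => v m + d (T m) (S n)) ≤
          v n + d (T n) (S n) := Finset.inf'_le _ hmem
        linarith [huv n, hsym (T n) (S n)]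
      · apply Finset.le_inf'
        intro m _
        linarith [key n m, hsym (T m) (S n)]
    have e2 : (Finset.range (K + 1)).inf' hne (fun m => v m + d (T m) (T n)) = v n := by
      apply le_antisymm
      · have h1 : (Finset.range (K + 1)).inf' hne (fun m => v m + d (T m) (T n)) ≤
          v n + d (T n) (T n) := Finset.inf'_le _ hmem
        linarith [h0 (T n)]
      · apply Finset.le_inf'
        intro m _
        linarith [key n m, huv n, htri (S n) (T n) (T m), htri (S n) (T m) (T n), hsym (T n) (T m)]
    simp only [e1, e2]
    exact huv n

/-- A set of pairs which is a staircase is realised by a 1-Lipschitz function. -/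
theorem staircase_set {N : ℕ} (d : Fin N → Fin N → ℝ) (hd : IsMetric d)
    (h : ∀ a b c' e : Fin N, a < b → b < c' → c' < e →
        d a b + d c' e > d a c' + d b e ∧ d a c' + d b e > d a e + d b c')
    (R : Fin N → Fin N → Prop) (hdis : ∀ s t s' t', R s t → R s' t' → s ≠ t')
    (hanti : ∀ s t s' t', R s t → R s' t' → s < s' → t' ≤ t) :
    ∃ f : Fin N → ℝ, (∀ x y, f x - f y ≤ d x y) ∧ ∀ s t, R s t → f s - f t = d s t := by
  classical
  let A : Finset (Fin N ×ₗ (Fin N)ᵒᵈ) :=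
    Finset.univ.filter (fun p => R (ofLex p).1 (OrderDual.ofDual (ofLex p).2))
  have hA : ∀ p, p ∈ A ↔ R (ofLex p).1 (OrderDual.ofDual (ofLex p).2) := by
    intro p; simp [A]
  rcases Nat.eq_zero_or_pos A.card with h0 | hpos
  · refine ⟨fun _ => 0, fun x y => ?_, fun s t hst => ?_⟩
    · rcases eq_or_ne x y with rfl | hxy
      · simp [hd.1]
      · simpa using (hd.2.2.1 x y hxy).le
    · exfalso
      have : toLex (s, OrderDual.toDual t) ∈ A := (hA _).2 hst
      rw [Finset.card_eq_zero] at h0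
      simp [h0] at this
  · let e := A.orderEmbOfFin rfl
    let p : ℕ → Fin N ×ₗ (Fin N)ᵒᵈ := fun n => e ⟨min n (A.card - 1), by omega⟩
    have hp : Monotone p := by
      intro m n hmn
      apply e.monotone
      simp only [Fin.mk_le_mk]
      omega
    have hpR : ∀ n, R (ofLex (p n)).1 (OrderDual.ofDual (ofLex (p n)).2) := by
      intro n
      exact (hA _).1 (Finset.orderEmbOfFin_mem A rfl _)
    obtain ⟨f, hf1, hf2⟩ := staircase_seq d hd h (fun n => (ofLex (p n)).1)
      (fun n => OrderDual.ofDual (ofLex (p n)).2)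
      (by
        intro m n hmn
        have := hp hmn
        rw [Prod.Lex.le_iff] at this
        rcases this with h1 | h1
        · exact h1.le
        · exact h1.1.le)
      (by
        intro m n hmn
        have := hp hmn
        rw [Prod.Lex.le_iff] at this
        rcases this with h1 | h1
        · exact hanti _ _ _ _ (hpR m) (hpR n) h1
        · exact h1.2)
      (by
        intro m n
        exact hdis _ _ _ _ (hpR m) (hpR n)) A.card
    refine ⟨f, hf1, fun s t hst => ?_⟩
    have hm : toLex (s, OrderDual.toDual t) ∈ A := (hA _).2 hst
    have : toLex (s, OrderDual.toDual t) ∈ Set.range e := by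
      rw [Finset.range_orderEmbOfFin]; exact hm
    obtain ⟨⟨n, hn⟩, hne⟩ := this
    have hpn : p n = toLex (s, OrderDual.toDual t) := by
      rw [← hne]
      simp only [p]
      congr 2
      omega
    have := hf2 n hn.le
    simpa [hpn] using this

/-- `R` is a staircase on `{0, …, N-1}` whose sources are at least `g`, and `g` is not a sink. -/
def IsStair (N g : ℕ) (R : ℕ → ℕ → Prop) : Prop :=
  (∀ s t, R s t → s < N ∧ t < N ∧ g ≤ s ∧ t ≠ g) ∧
  (∀ s t s' t', R s t → R s' t' → s ≠ t') ∧
  (∀ s t s' t', R s t → R s' t' → s < s' → t' ≤ t)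

/-- A system of staircases indexed by the points other than `x 0 < ⋯ < x (c-1)`
that covers every pair of points. -/
def IsCover (N c : ℕ) (x : ℕ → ℕ) (E : ℕ → ℕ → ℕ → Prop) : Prop :=
  (∀ k < c, x k < N) ∧ (∀ j k, j < k → k < c → x j < x k) ∧
  (∀ g < N, (∀ k < c, x k ≠ g) → IsStair N g (E g)) ∧
  (∀ i j, i < j → j < N → ∃ g < N, (∀ k < c, x k ≠ g) ∧ (E g i j ∨ E g j i))

theorem cover_base : IsCover 2 1 (fun _ => 1) (fun _ s t => s = 0 ∧ t = 1) := by
  refine ⟨by simp, by omega, ?_, ?_⟩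
  · intro g hg hk
    have : (1 : ℕ) ≠ g := hk 0 (by omega)
    refine ⟨?_, ?_, ?_⟩ <;> intros <;> omega
  · intro i j hij hj
    exact ⟨0, by omega, by simp, by omega⟩

theorem cover_step (N c : ℕ) (hc : 0 < c) (x : ℕ → ℕ) (E : ℕ → ℕ → ℕ → Prop)
    (hE : IsCover N c x E) : ∃ x' E', IsCover (N + c + 2) (c + 1) x' E' := by
  obtain ⟨hx, hmono, hst, hcov⟩ := hE
  have hle : ∀ j k, j ≤ k → k < c → x j ≤ x k := by
    intro j k hjk hk
    rcases hjk.eq_or_lt with rfl | h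
    · exact le_rfl
    · exact (hmono j k h hk).le
  let x' : ℕ → ℕ := fun k => if k + 1 < c then x (k + 1) else N + k + 1
  let Ra : ℕ → ℕ → Prop := fun s t => ((∃ k < c, s = x k) ∧ t = N + c + 1) ∨
    (s = N + c ∧ N ≤ t ∧ t ≠ N + c ∧ t ≤ N + c + 1)
  let Rb : ℕ → ℕ → ℕ → Prop := fun k s t => (N + k < s ∧ s ≤ N + c ∧ t = x k) ∨
    (s = N + k ∧ ((∃ j < c, k ≤ j ∧ t = x j) ∨ (N ≤ t ∧ t < N + k) ∨ t = N + c + 1))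
  let Ro : ℕ → ℕ → ℕ → Prop := fun g s t => E g s t ∨ (s = g ∧ N ≤ t ∧ t < N + c + 2)
  let E' : ℕ → ℕ → ℕ → Prop := fun g =>
    if g < N then (if g = x 0 then Ra else Ro g) else Rb (g - N)
  have hEa : E' (x 0) = Ra := by simp [E', hx 0 hc]
  have hEb : ∀ k, E' (N + k) = Rb k := by intro k; simp [E']
  have hEo : ∀ g < N, (∀ k < c, x k ≠ g) → E' g = Ro g := by
    intro g hg hk
    have := (hk 0 hc).symm
    simp [E', hg, this]
  have good_old : ∀ g < N, (∀ k < c, x k ≠ g) → ∀ k < c + 1, x' k ≠ g := by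
    intro g hg hk k _
    simp only [x']
    split_ifs with h
    · exact hk _ h
    · omega
  have good_a : ∀ k < c + 1, x' k ≠ x 0 := by
    intro k _
    have h0 := hx 0 hc
    simp only [x']
    split_ifs with h
    · exact (hmono 0 (k+1) (by omega) h).ne'
    · omega
  have good_b : ∀ i < c, ∀ k < c + 1, x' k ≠ N + i := by
    intro i hi k _
    simp only [x']
    split_ifs with h
    · have := hx _ h; omega
    · omega
  refine ⟨x', E', ?_, ?_, ?_, ?_⟩
  · intro k hk
    simp only [x']
    split_ifs with h
    · have := hx _ h; omega
    · omega
  · intro j k hjk hk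
    simp only [x']
    split_ifs with h1 h2 h2
    · exact hmono _ _ (by omega) h2
    · have := hx _ h1; omega
    · omega
    · omega
  · intro g hg hk
    by_cases hgN : g < N
    · by_cases hgx : ∀ k < c, x k ≠ g
      · rw [hEo g hgN hgx]
        obtain ⟨o1, o2, o3⟩ := hst g hgN hgx
        refine ⟨?_, ?_, ?_⟩
        · rintro s t (h | h)
          · have := o1 s t h; omega
          · omega
        · rintro s t s' t' (h | h) (h' | h')
          · exact o2 _ _ _ _ h h'
          · have := o1 s t h; omega
          · have := o1 _ _ h'; omega
          · omega
        · rintro s t s' t' (h | h) (h' | h') hlt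
          · exact o3 _ _ _ _ h h' hlt
          · have := o1 s t h; omega
          · have := o1 _ _ h'; omega
          · omega
      · push Not at hgx
        obtain ⟨k, hkc, rfl⟩ := hgx
        have hk0 : k = 0 := by
          by_contra hne
          apply hk (k - 1) (by omega)
          have e : k - 1 + 1 = k := by omega
          simp [x', e, hkc]
        subst hk0
        rw [hEa]
        have h0 := hx 0 hc
        refine ⟨?_, ?_, ?_⟩
        · rintro s t (⟨⟨k, hk, rfl⟩, h⟩ | h)
          · have := hx k hk
            have := hle 0 k (by omega) hk
            omega
          · omega
        · rintro s t s' t' (⟨⟨k, hk, rfl⟩, h⟩ | h) (⟨⟨k', hk', rfl⟩, h'⟩ | h')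
          · have := hx k hk; omega
          · have := hx k hk; omega
          · omega
          · omega
        · rintro s t s' t' (⟨⟨k, hk, rfl⟩, h⟩ | h) (⟨⟨k', hk', rfl⟩, h'⟩ | h') hlt
          · omega
          · omega
          · have := hx k' hk'; omega
          · omega
    · obtain ⟨i, rfl⟩ := Nat.exists_eq_add_of_le (not_lt.1 hgN)
      have hi : i < c := by
        by_contra hic
        apply hk (i - 1) (by omega)
        have : ¬ (i - 1 + 1 < c) := by omega
        simp only [x', this, if_false]
        omega
      rw [hEb]
      have hxi := hx i hi
      refine ⟨?_, ?_, ?_⟩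
      · rintro s t (h | ⟨h, ⟨j, hj, hij, rfl⟩ | h2 | h2⟩)
        · omega
        · have := hx j hj; omega
        · omega
        · omega
      · rintro s t s' t' (h | ⟨h, ⟨j, hj, hij, rfl⟩ | h2 | h2⟩)
          (h' | ⟨h', ⟨j', hj', hij', rfl⟩ | h2' | h2'⟩) <;>
        first
        | omega
        | (have := hx j' hj'; omega)
      · rintro s t s' t' (h | ⟨h, ⟨j, hj, hij, rfl⟩ | h2 | h2⟩)
          (h' | ⟨h', ⟨j', hj', hij', rfl⟩ | h2' | h2'⟩) hlt <;>
        first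
        | omega
        | (have := hle i j hij hj; omega)
  · intro i j hij hj
    by_cases hjN : j < N
    · obtain ⟨g, hg, hgx, h⟩ := hcov i j hij hjN
      refine ⟨g, by omega, good_old g hg hgx, ?_⟩
      rw [hEo g hg hgx]
      exact h.imp Or.inl Or.inl
    · by_cases hiN : i < N
      · by_cases hix : ∀ k < c, x k ≠ i
        · refine ⟨i, by omega, good_old i hiN hix, ?_⟩
          rw [hEo i hiN hix]
          exact Or.inl (Or.inr ⟨rfl, by omega, by omega⟩)
        · push Not at hix
          obtain ⟨k, hk, rfl⟩ := hix
          by_cases hz : j = N + c + 1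
          · refine ⟨x 0, by have := hx 0 hc; omega, good_a, ?_⟩
            rw [hEa]
            exact Or.inl (Or.inl ⟨⟨k, hk, rfl⟩, hz⟩)
          · by_cases hjk : N + k < j
            · refine ⟨N + k, by omega, good_b k hk, ?_⟩
              rw [hEb]
              exact Or.inr (Or.inl ⟨hjk, by omega, rfl⟩)
            · obtain ⟨l, rfl⟩ := Nat.exists_eq_add_of_le (not_lt.1 hjN)
              refine ⟨N + l, by omega, good_b l (by omega), ?_⟩
              rw [hEb]
              exact Or.inr (Or.inr ⟨rfl, Or.inl ⟨k, hk, by omega, rfl⟩⟩)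
      · by_cases hja : j < N + c
        · obtain ⟨l, rfl⟩ := Nat.exists_eq_add_of_le (not_lt.1 hjN)
          refine ⟨N + l, by omega, good_b l (by omega), ?_⟩
          rw [hEb]
          exact Or.inr (Or.inr ⟨rfl, Or.inr (Or.inl ⟨by omega, hij⟩)⟩)
        · by_cases hz : j = N + c + 1 ∧ i < N + c
          · obtain ⟨l, rfl⟩ := Nat.exists_eq_add_of_le (not_lt.1 hiN)
            refine ⟨N + l, by omega, good_b l (by omega), ?_⟩
            rw [hEb]
            exact Or.inl (Or.inr ⟨rfl, Or.inr (Or.inr hz.1)⟩)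
          · refine ⟨x 0, by have := hx 0 hc; omega, good_a, ?_⟩
            rw [hEa]
            by_cases hja' : j = N + c
            · exact Or.inr (Or.inr ⟨hja', by omega, by omega, by omega⟩)
            · exact Or.inl (Or.inr ⟨by omega, by omega, by omega, by omega⟩)

theorem cover_exists (c : ℕ) (hc : 0 < c) : ∃ N x E, c < N ∧ IsCover N c x E := by
  induction c, hc using Nat.le_induction with
  | base => exact ⟨2, _, _, by omega, cover_base⟩
  | succ c hc ih =>
    obtain ⟨N, x, E, hN, h⟩ := ih
    obtain ⟨x', E', h'⟩ := cover_step N c hc x E h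
    exact ⟨N + c + 2, x', E', by omega, h'⟩

/-- The substantive form: the number of points `N` is larger than `c`, so that the target
`l_∞^{N-c}` has positive dimension. -/
theorem monochromatic_123_embeds_strong (c : ℕ) (hc : 0 < c) :
    ∃ N : ℕ, c < N ∧ ∀ d : Fin N → Fin N → ℝ, IsMetric d →
      (∀ a b c' e : Fin N, a < b → b < c' → c' < e →
        d a b + d c' e > d a c' + d b e ∧ d a c' + d b e > d a e + d b c') →
      ∃ f : Fin N → LinfSpace (N - c), ∀ x y : Fin N, dist (f x) (f y) = d x y := by
  obtain ⟨N, x, E, hN, hx, hmono, hst, hcov⟩ := cover_exists c hc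
  refine ⟨N, hN, fun d hd h => ?_⟩
  classical
  let G : Finset ℕ := Finset.range N \ (Finset.range c).image x
  have hG : ∀ g, g ∈ G ↔ g < N ∧ ∀ k < c, x k ≠ g := by
    intro g; simp [G]
  have hcard : G.card = N - c := by
    rw [Finset.card_sdiff_of_subset, Finset.card_image_of_injOn, Finset.card_range,
      Finset.card_range]
    · intro a ha b hb hab
      simp only [Finset.coe_range, Set.mem_Iio] at ha hb
      rcases lt_trichotomy a b with h1 | h1 | h1
      · exact absurd hab (hmono _ _ h1 hb).ne
      · exact h1
      · exact absurd hab (hmono _ _ h1 ha).ne'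
    · intro y hy
      simp only [Finset.mem_image, Finset.mem_range] at hy ⊢
      obtain ⟨k, hk, rfl⟩ := hy
      exact hx k hk
  have hF : ∀ g : ℕ, ∃ f : Fin N → ℝ, g ∈ G → ((∀ x y, f x - f y ≤ d x y) ∧
      ∀ s t : Fin N, E g s t → f s - f t = d s t) := by
    intro g
    by_cases hg : g ∈ G
    · obtain ⟨o1, o2, o3⟩ := hst g ((hG g).1 hg).1 ((hG g).1 hg).2
      obtain ⟨f, hf⟩ := staircase_set d hd h (fun s t => E g s t)
        (fun s t s' t' a b e => o2 _ _ _ _ a b (congrArg Fin.val e))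
        (fun s t s' t' a b e => o3 _ _ _ _ a b e)
      exact ⟨f, fun _ => hf⟩
    · exact ⟨0, fun h => absurd h hg⟩
  choose F hF using hF
  let e := G.orderEmbOfFin hcard
  have he : ∀ i, e i ∈ G := fun i => Finset.orderEmbOfFin_mem G hcard i
  have hLip : ∀ i y z, |F (e i) y - F (e i) z| ≤ d y z := by
    intro i y z
    rw [abs_le]
    have h1 := (hF _ (he i)).1 y z
    have h2 := (hF _ (he i)).1 z y
    have h3 := hd.2.1 y z
    constructor <;> linarith
  have hnn : ∀ y z, 0 ≤ d y z := by
    intro y z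
    exact (abs_nonneg _).trans (hLip ⟨0, by omega⟩ y z)
  have hcov' : ∀ y z : Fin N, y < z → ∃ i, d y z ≤ |F (e i) y - F (e i) z| := by
    intro y z hyz
    obtain ⟨g, hg, hgx, hE⟩ := hcov y z hyz z.2
    have hgG : g ∈ G := (hG g).2 ⟨hg, hgx⟩
    have : g ∈ Set.range e := by rw [Finset.range_orderEmbOfFin]; exact hgG
    obtain ⟨i, rfl⟩ := this
    refine ⟨i, ?_⟩
    rcases hE with hE | hE
    · rw [(hF _ hgG).2 _ _ hE]; exact le_abs_self _
    · rw [abs_sub_comm, (hF _ hgG).2 _ _ hE, hd.2.1]; exact le_abs_self _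
  refine ⟨fun y => WithLp.toLp ⊤ (fun i => F (e i) y), fun y z => ?_⟩
  rw [PiLp.dist_eq_iSup]
  simp only [Real.dist_eq]
  apply le_antisymm
  · exact Real.iSup_le (fun i => hLip i y z) (hnn y z)
  · have hle : ∀ i, |F (e i) y - F (e i) z| ≤ ⨆ i, |F (e i) y - F (e i) z| :=
      fun i => le_ciSup (f := fun i => |F (e i) y - F (e i) z|) (Set.finite_range _).bddAbove i
    rcases lt_trichotomy y z with h1 | rfl | h1
    · obtain ⟨i, hi⟩ := hcov' y z h1
      exact hi.trans (hle i)
    · rw [hd.1]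
      exact (abs_nonneg _).trans (hle ⟨0, by omega⟩)
    · obtain ⟨i, hi⟩ := hcov' z y h1
      rw [hd.2.1, ]
      rw [abs_sub_comm] at hi
      exact hi.trans (hle i)

/-- For every positive integer `c` there exists `N` such that every metric on `N`
ordered points which is monochromatic of colour 123 — every quadruple
`a < b < c < e` satisfies `R₁ > R₂ > R₃`, where `R₁ = d a b + d c e`,
`R₂ = d a c + d b e`, `R₃ = d a e + d b c` — embeds isometrically into `l_∞^{N-c}`. -/
theorem monochromatic_123_embeds (c : ℕ) (hc : 0 < c) :
    ∃ N : ℕ, ∀ d : Fin N → Fin N → ℝ, IsMetric d →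
      (∀ a b c' e : Fin N, a < b → b < c' → c' < e →
        d a b + d c' e > d a c' + d b e ∧ d a c' + d b e > d a e + d b c') →
      ∃ f : Fin N → LinfSpace (N - c), ∀ x y : Fin N, dist (f x) (f y) = d x y := by
  obtain ⟨N, _, hN⟩ := monochromatic_123_embeds_strong c hc
  exact ⟨N, hN⟩
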